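/- Let S and S′ be stretches with S′ > S and d(S,S′) = 1. Then S′ is up-admissible for v and S is up-admissible for v(S′) if and only if S is down-admissible for v and S′ is up-admissible for v[S]. In this case v(S′)(S) = v[S](S′). -/

import Mathlib

namespace SL2Tilt

/-- The `i`-th `p`-adic digit of `v`. -/
def dig (p v i : ℕ) : ℕ := v / p ^ i % p

/-- A stretch: a nonempty finite set of consecutive integers. -/
def IsStretch (S : Finset ℕ) : Prop :=
  S.Nonempty ∧ ∀ a ∈ S, ∀ b ∈ S, ∀ c, a ≤ c → c ≤ b → c ∈ S

/-- `S` is down-admissible for `v` (with respect to the prime `p`):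
(d1) the digit of `v` at the minimum of each maximal stretch of `S` is nonzero, and
(d2) if `s ∈ S` and the `(s+1)`-st digit is `0`, then `s + 1 ∈ S`. -/
def DownAdm (p v : ℕ) (S : Finset ℕ) : Prop :=
  (∀ s ∈ S, (s = 0 ∨ s - 1 ∉ S) → dig p v s ≠ 0) ∧
  (∀ s ∈ S, dig p v (s + 1) = 0 → s + 1 ∈ S)

/-- `S` is up-admissible for `v` (with respect to the prime `p`):
(u1) the digit of `v` at the minimum of each maximal stretch of `S` is nonzero, and
(u2) if `s ∈ S` and the `(s+1)`-st digit is `p - 1`, then `s + 1 ∈ S`. -/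
def UpAdm (p v : ℕ) (S : Finset ℕ) : Prop :=
  (∀ s ∈ S, (s = 0 ∨ s - 1 ∉ S) → dig p v s ≠ 0) ∧
  (∀ s ∈ S, dig p v (s + 1) = p - 1 → s + 1 ∈ S)

/-- `v[S] = ∑ᵢ εᵢ aᵢ pⁱ` (εᵢ = -1 for i ∈ S, else 1), as an integer.
All nonzero digits of `v` have index `< v`, so the range `Finset.range v ∪ S` suffices. -/
def vdown (p v : ℕ) (S : Finset ℕ) : ℤ :=
  ∑ i ∈ Finset.range v ∪ S,
    (if i ∈ S then (-1 : ℤ) else 1) * (dig p v i : ℤ) * (p : ℤ) ^ i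

/-- `v(S) = ∑ᵢ aᵢ' pⁱ` where `aᵢ' = -aᵢ` if `i ∈ S`, `aᵢ' = aᵢ + 2` if `i ∉ S` and
`i - 1 ∈ S`, and `aᵢ' = aᵢ` otherwise; as an integer. -/
def vup (p v : ℕ) (S : Finset ℕ) : ℤ :=
  ∑ i ∈ Finset.range v ∪ S ∪ S.image (· + 1),
    (if i ∈ S then -(dig p v i : ℤ)
      else if i - 1 ∈ S then (dig p v i : ℤ) + 2
      else (dig p v i : ℤ)) * (p : ℤ) ^ i

/-- `v[S]` as a natural number. -/
def vdownN (p v : ℕ) (S : Finset ℕ) : ℕ := (vdown p v S).toNat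

/-- `v(S)` as a natural number. -/
def vupN (p v : ℕ) (S : Finset ℕ) : ℕ := (vup p v S).toNat

/-- `fancest' p v s` is `v` with the `p`-adic digits in positions `< s` set to zero.
This is the ancestor `fancest_{s-1}(v)` of the paper: the youngest ancestor of `v`
whose `(s-1)`-st digit is zero (with `fancest' p v 0 = fancest_{-1}(v) = v`). -/
def fancest' (p v s : ℕ) : ℕ := p ^ s * (v / p ^ s)

/-- The scalar `λ_{v,S} = ∏_{s ∈ S} (-1)^(a_s p^s) · fancest_{s-1}(v)[S]± / fancest_s(v)[S]±`. -/
def lam (p v : ℕ) (S : Finset ℕ) : ℚ :=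
  ∏ s ∈ S,
    (-1 : ℚ) ^ (dig p v s * p ^ s) *
      ((vdown p (fancest' p v s) S : ℚ) / (vdown p (fancest' p v (s + 1)) S : ℚ))

/-- The generation of `v` : the number of (matrilineal) ancestors of `v`, i.e. the
number of nonzero `p`-adic digits of `v` minus one. -/
def gen (p v : ℕ) : ℕ :=
  ((Finset.range v).filter (fun i => dig p v i ≠ 0)).card - 1

/-- A minimal down-admissible stretch for `v`: a down-admissible stretch, no proper
nonempty subset of which is down-admissible for `v`. -/
def MinDownStretch (p v : ℕ) (S : Finset ℕ) : Prop :=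
  DownAdm p v S ∧ IsStretch S ∧ ∀ T ⊂ S, T.Nonempty → ¬ DownAdm p v T

/-- A minimal up-admissible stretch for `v`. -/
def MinUpStretch (p v : ℕ) (S : Finset ℕ) : Prop :=
  UpAdm p v S ∧ IsStretch S ∧ ∀ T ⊂ S, T.Nonempty → ¬ UpAdm p v T

/-- `A` and `B` are distant: `d(A,B) > 1`, i.e. `|a - b| > 1` for all `a ∈ A`, `b ∈ B`. -/
def Distant (A B : Finset ℕ) : Prop :=
  ∀ a ∈ A, ∀ b ∈ B, a + 1 < b ∨ b + 1 < a

theorem sum_dig (p v n : ℕ) :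
    ∑ i ∈ Finset.range n, (dig p v i : ℤ) * (p : ℤ) ^ i = ((v % p ^ n : ℕ) : ℤ) := by
  induction n with
  | zero => simp [Nat.mod_one]
  | succ k ih =>
    rw [Finset.sum_range_succ, ih, Nat.mod_pow_succ]
    unfold dig
    push_cast
    ring

theorem dig_big (p v i : ℕ) (hp : 2 ≤ p) (h : v ≤ i) : dig p v i = 0 := by
  unfold dig
  have : v < p ^ i := lt_of_lt_of_le (Nat.lt_pow_self (by omega)) (Nat.pow_le_pow_right (by omega) h)
  rw [Nat.div_eq_of_lt this, Nat.zero_mod]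

theorem sum_dig_Ico (p v b c : ℕ) (h : b ≤ c) :
    ∑ i ∈ Finset.Ico b c, (dig p v i : ℤ) * (p : ℤ) ^ i
      = ((v % p ^ c : ℕ) : ℤ) - ((v % p ^ b : ℕ) : ℤ) := by
  rw [← sum_dig, ← sum_dig, Finset.sum_Ico_eq_sub _ h]

theorem sum_dig_all (p v N : ℕ) (hp : 2 ≤ p) (h : v ≤ N) :
    ∑ i ∈ Finset.range N, (dig p v i : ℤ) * (p : ℤ) ^ i = (v : ℤ) := by
  rw [sum_dig, Nat.mod_eq_of_lt]
  exact lt_of_lt_of_le (Nat.lt_pow_self (by omega)) (Nat.pow_le_pow_right (by omega) h)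

theorem sum_ite_Ico (f : ℕ → ℤ) (b c N : ℕ) (h : c ≤ N) :
    ∑ i ∈ Finset.range N, (if i ∈ Finset.Ico b c then f i else 0) = ∑ i ∈ Finset.Ico b c, f i := by
  rw [← Finset.sum_filter]
  congr 1
  ext i
  simp only [Finset.mem_filter, Finset.mem_range, Finset.mem_Ico]
  omega

theorem vdown_eq (p v b c : ℕ) (hp : 2 ≤ p) (h : b < c) :
    vdown p v (Finset.Ico b c)
      = (v : ℤ) - 2 * (((v % p ^ c : ℕ) : ℤ) - ((v % p ^ b : ℕ) : ℤ)) := by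
  unfold vdown
  rw [Finset.sum_subset (s₂ := Finset.range (v + c + 1))]
  · rw [← sum_dig_all p v (v + c + 1) hp (by omega), ← sum_dig_Ico p v b c h.le,
      ← sum_ite_Ico _ b c (v + c + 1) (by omega), Finset.mul_sum, ← Finset.sum_sub_distrib]
    refine Finset.sum_congr rfl fun i _ => ?_
    split_ifs <;> ring
  · intro i
    simp only [Finset.mem_union, Finset.mem_range, Finset.mem_Ico]
    omega
  · intro i _ hi
    simp only [Finset.mem_union, Finset.mem_range, Finset.mem_Ico] at hi
    rw [dig_big p v i hp (by omega)]
    simp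

theorem vup_eq (p v b c : ℕ) (hp : 2 ≤ p) (h : b < c) :
    vup p v (Finset.Ico b c)
      = (v : ℤ) - 2 * (((v % p ^ c : ℕ) : ℤ) - ((v % p ^ b : ℕ) : ℤ)) + 2 * (p : ℤ) ^ c := by
  unfold vup
  rw [Finset.sum_subset (s₂ := Finset.range (v + c + 1))]
  · have h1 : 2 * (p : ℤ) ^ c
        = ∑ i ∈ Finset.range (v + c + 1), (if i = c then 2 * (p : ℤ) ^ i else 0) := by
      rw [Finset.sum_ite_eq' (Finset.range (v + c + 1)) c (fun i => 2 * (p : ℤ) ^ i),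
        if_pos (Finset.mem_range.mpr (by omega))]
    rw [h1, ← sum_dig_all p v (v + c + 1) hp (by omega), ← sum_dig_Ico p v b c h.le,
      ← sum_ite_Ico _ b c (v + c + 1) (by omega), Finset.mul_sum, ← Finset.sum_sub_distrib,
      ← Finset.sum_add_distrib]
    refine Finset.sum_congr rfl fun i _ => ?_
    simp only [Finset.mem_Ico]
    split_ifs <;> first | (exfalso; omega) | ring
  · intro i
    simp only [Finset.mem_union, Finset.mem_range, Finset.mem_Ico, Finset.mem_image]
    rintro ((h | h) | ⟨x, hx, rfl⟩) <;> omega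
  · intro i _ hi
    simp only [Finset.mem_union, Finset.mem_range, Finset.mem_Ico, Finset.mem_image, not_or,
      not_exists, not_and] at hi
    obtain ⟨⟨h1, h2⟩, h3⟩ := hi
    have h4 : ¬ (b ≤ i - 1 ∧ i - 1 < c) := by
      intro h5
      by_cases h6 : i = 0
      · omega
      · exact h3 (i - 1) h5 (by omega)
    simp only [Finset.mem_Ico]
    rw [if_neg (by omega), if_neg h4, dig_big p v i hp (by omega)]
    simp

theorem upAdm_Ico (p v b c : ℕ) (h : b < c) :
    UpAdm p v (Finset.Ico b c) ↔ dig p v b ≠ 0 ∧ dig p v c ≠ p - 1 := by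
  unfold UpAdm
  simp only [Finset.mem_Ico]
  constructor
  · rintro ⟨h1, h2⟩
    refine ⟨h1 b (by omega) (by omega), fun h3 => ?_⟩
    have := h2 (c - 1) (by omega)
    rw [show c - 1 + 1 = c by omega] at this
    have := this h3
    omega
  · rintro ⟨h1, h2⟩
    refine ⟨fun s hs h3 => ?_, fun s hs h3 => ?_⟩
    · obtain rfl : s = b := by omega
      exact h1
    · by_contra h4
      obtain rfl : s + 1 = c := by omega
      exact h2 h3

theorem downAdm_Ico (p v b c : ℕ) (h : b < c) :
    DownAdm p v (Finset.Ico b c) ↔ dig p v b ≠ 0 ∧ dig p v c ≠ 0 := by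
  unfold DownAdm
  simp only [Finset.mem_Ico]
  constructor
  · rintro ⟨h1, h2⟩
    refine ⟨h1 b (by omega) (by omega), fun h3 => ?_⟩
    have := h2 (c - 1) (by omega)
    rw [show c - 1 + 1 = c by omega] at this
    have := this h3
    omega
  · rintro ⟨h1, h2⟩
    refine ⟨fun s hs h3 => ?_, fun s hs h3 => ?_⟩
    · obtain rfl : s = b := by omega
      exact h1
    · by_contra h4
      obtain rfl : s + 1 = c := by omega
      exact h2 h3

theorem dig_low (p v w a b : ℕ) (h : a < b) (hm : v % p ^ b = w % p ^ b) :
    dig p v a = dig p w a := by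
  unfold dig
  have h1 : v % p ^ (a + 1) = w % p ^ (a + 1) := by
    have hd : p ^ (a + 1) ∣ p ^ b := pow_dvd_pow p (by omega)
    rw [← Nat.mod_mod_of_dvd v hd, hm, Nat.mod_mod_of_dvd w hd]
  rw [pow_succ] at h1
  rw [← Nat.mod_mul_right_div_self, ← Nat.mod_mul_right_div_self, h1]

theorem exists_Ico (S S' : Finset ℕ)
    (hS : IsStretch S) (hS' : IsStretch S')
    (hlt : ∀ a ∈ S, ∀ b ∈ S', a < b)
    (hadj : ∃ a ∈ S, a + 1 ∈ S') :
    ∃ a b c, a < b ∧ b < c ∧ S = Finset.Ico a b ∧ S' = Finset.Ico b c := by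
  obtain ⟨x, hx, hx'⟩ := hadj
  have hmin := S.min'_mem hS.1
  have hmax := S'.max'_mem hS'.1
  have h1 := S.min'_le x hx
  have h2 := S'.le_max' _ hx'
  refine ⟨S.min' hS.1, x + 1, S'.max' hS'.1 + 1, by omega, by omega, ?_, ?_⟩
  · ext i
    rw [Finset.mem_Ico]
    constructor
    · intro hi
      exact ⟨S.min'_le i hi, hlt i hi _ hx'⟩
    · rintro ⟨h3, h4⟩
      exact hS.2 _ hmin _ hx i h3 (by omega)
  · ext i
    rw [Finset.mem_Ico]
    constructor
    · intro hi
      have := S'.le_max' i hi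
      have := hlt x hx i hi
      omega
    · rintro ⟨h3, h4⟩
      exact hS'.2 _ hx' _ hmax i h3 (by omega)

theorem up_data (p v b c : ℕ) (hp : 2 ≤ p) (h : b < c) :
    ((vupN p v (Finset.Ico b c) : ℕ) : ℤ)
      = (v : ℤ) - 2 * (((v % p ^ c : ℕ) : ℤ) - ((v % p ^ b : ℕ) : ℤ)) + 2 * (p : ℤ) ^ c ∧
    vupN p v (Finset.Ico b c) % p ^ b = v % p ^ b ∧
    (dig p (vupN p v (Finset.Ico b c)) b = p - 1 ↔ dig p v b = 1) := by
  obtain ⟨n, rfl⟩ : ∃ n, c = b + (n + 1) := ⟨c - b - 1, by omega⟩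
  have hP : 0 < p ^ b := by positivity
  have hlt : v % p ^ (b + (n + 1)) < p ^ (b + (n + 1)) := Nat.mod_lt _ (by positivity)
  have hw : ((vupN p v (Finset.Ico b (b + (n + 1))) : ℕ) : ℤ)
      = (v : ℤ) - 2 * (((v % p ^ (b + (n + 1)) : ℕ) : ℤ) - ((v % p ^ b : ℕ) : ℤ))
        + 2 * (p : ℤ) ^ (b + (n + 1)) := by
    unfold vupN
    rw [vup_eq p v b _ hp h, Int.toNat_of_nonneg]
    have : ((v % p ^ (b + (n + 1)) : ℕ) : ℤ) < (p : ℤ) ^ (b + (n + 1)) := by exact_mod_cast hlt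
    have h5 := Int.natCast_nonneg (v % p ^ b)
    have h6 := Int.natCast_nonneg v
    linarith
  generalize vupN p v (Finset.Ico b (b + (n + 1))) = w at *
  have hmod : v % p ^ (b + (n + 1)) = v % p ^ b + p ^ b * (v / p ^ b % p ^ (n + 1)) := by
    rw [pow_add, Nat.mod_mul]
  have hq := Nat.mod_add_div v (p ^ b)
  have hrlt := Nat.mod_lt v hP
  set r := v % p ^ b with hr
  set q := v / p ^ b with hq'
  have hBq := Nat.mod_le q (p ^ (n + 1))
  have hBlt := Nat.mod_lt q (show 0 < p ^ (n + 1) by positivity)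
  have hBp : q % p ^ (n + 1) % p = q % p := Nat.mod_mod_of_dvd q (dvd_pow_self p (by omega))
  set B := q % p ^ (n + 1) with hB
  obtain ⟨K, hK⟩ : ∃ K : ℕ, K + 2 * B = q + 2 * p ^ (n + 1) := ⟨q + 2 * p ^ (n + 1) - 2 * B, by omega⟩
  have hwK : w = r + p ^ b * K := by
    have hmod' : ((v % p ^ (b + (n + 1)) : ℕ) : ℤ) = r + (p : ℤ) ^ b * B := by
      rw [hmod]
      push_cast
      rfl
    zify at hK hq ⊢
    rw [hw, hmod', ← hq, show (K : ℤ) = q + 2 * p ^ (n + 1) - 2 * B by linarith, pow_add]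
    ring
  refine ⟨hw, ?_, ?_⟩
  · rw [hwK, Nat.add_mul_mod_self_left, Nat.mod_eq_of_lt hrlt]
  · unfold dig
    rw [hwK, Nat.add_mul_div_left _ _ hP, Nat.div_eq_of_lt hrlt, zero_add, ← hq']
    have h1 : (K + q) % p = 0 := by
      have e1 : K + 2 * B ≡ q [MOD p] := by
        rw [hK]
        unfold Nat.ModEq
        rw [pow_succ, show q + 2 * (p ^ n * p) = q + p * (2 * p ^ n) by ring,
          Nat.add_mul_mod_self_left]
      have e2 : B ≡ q [MOD p] := hBp
      have e3 : K + 2 * q ≡ q [MOD p] := ((e2.mul_left 2).add_left K).symm.trans e1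
      have e4 : (K + q) + q ≡ 0 + q [MOD p] := by
        rw [zero_add, show K + q + q = K + 2 * q by ring]; exact e3
      have := Nat.ModEq.add_right_cancel' q e4
      simpa [Nat.ModEq] using this
    have h2 := Nat.mod_lt K (show 0 < p by omega)
    have h3 := Nat.mod_lt q (show 0 < p by omega)
    rw [Nat.add_mod] at h1
    obtain ⟨t, ht⟩ := Nat.dvd_of_mod_eq_zero h1
    have ht2 : t < 2 := by
      by_contra h
      have : p * 2 ≤ p * t := Nat.mul_le_mul_left p (by omega)
      omega
    interval_cases t <;> omega

theorem down_data (p v a b : ℕ) (hp : 2 ≤ p) (h : a < b)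
    (ha : dig p v a ≠ 0) (hb : dig p v b ≠ 0) :
    ((vdownN p v (Finset.Ico a b) : ℕ) : ℤ)
      = (v : ℤ) - 2 * (((v % p ^ b : ℕ) : ℤ) - ((v % p ^ a : ℕ) : ℤ)) ∧
    (dig p (vdownN p v (Finset.Ico a b)) b + 1 = dig p v b) ∧
    ∀ c, b < c → dig p (vdownN p v (Finset.Ico a b)) c = dig p v c ∧
      ((vdownN p v (Finset.Ico a b) % p ^ c : ℕ) : ℤ) - ((vdownN p v (Finset.Ico a b) % p ^ b : ℕ) : ℤ)
        = ((v % p ^ c : ℕ) : ℤ) - ((v % p ^ b : ℕ) : ℤ) - (p : ℤ) ^ b := by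
  have hP : 0 < p ^ b := by positivity
  have hPa : 0 < p ^ a := by positivity
  have hq := Nat.mod_add_div v (p ^ b)
  have hrlt := Nat.mod_lt v hP
  have hllt := Nat.mod_lt v hPa
  have h1 : v % p ^ a + p ^ a ≤ v % p ^ b := by
    have e1 : v % p ^ (a + 1) ≤ v % p ^ b := by
      rw [← Nat.mod_mod_of_dvd v (pow_dvd_pow p (show a + 1 ≤ b by omega))]
      exact Nat.mod_le _ _
    rw [Nat.mod_pow_succ] at e1
    have e2 : p ^ a * 1 ≤ p ^ a * (v / p ^ a % p) :=
      Nat.mul_le_mul_left _ (Nat.one_le_iff_ne_zero.mpr ha)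
    omega
  unfold dig at hb
  have hu : ((vdownN p v (Finset.Ico a b) : ℕ) : ℤ)
      = (v : ℤ) - 2 * (((v % p ^ b : ℕ) : ℤ) - ((v % p ^ a : ℕ) : ℤ)) := by
    unfold vdownN
    rw [vdown_eq p v a b hp h, Int.toNat_of_nonneg]
    have : p ^ b * 1 ≤ p ^ b * (v / p ^ b) := by
      apply Nat.mul_le_mul_left
      apply Nat.one_le_iff_ne_zero.mpr
      intro h0
      rw [h0] at hb
      simp at hb
    have h5 := Int.natCast_nonneg (v % p ^ a)
    zify at this hq hrlt
    push_cast at h5 ⊢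
    linarith
  generalize vdownN p v (Finset.Ico a b) = u at *
  set r := v % p ^ b with hr
  set l := v % p ^ a with hl
  have hdb : dig p v b = v / p ^ b % p := rfl
  set q := v / p ^ b with hq'
  obtain ⟨k, hk⟩ : ∃ k, q = k + 1 := by
    apply Nat.exists_eq_succ_of_ne_zero
    intro h0
    rw [h0] at hb
    simp at hb
  obtain ⟨s, hs⟩ : ∃ s, s + r = 2 * l + p ^ b := ⟨2 * l + p ^ b - r, by omega⟩
  have hslt : s < p ^ b := by omega
  have huk : u = s + p ^ b * k := by
    rw [hk] at hq
    zify at hq hs ⊢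
    rw [hu]
    linarith
  have hdec : ∀ M, p ∣ M → 0 < M → k % M + 1 = q % M ∧ k / M = q / M := by
    intro M hM hM0
    have e0 : q % M ≠ 0 := by
      intro h0
      apply hb
      rw [← Nat.mod_mod_of_dvd q hM, h0, Nat.zero_mod]
    have e1 := Nat.mod_add_div q M
    have e2 := Nat.mod_lt q hM0
    have e3 : k = (q % M - 1) + M * (q / M) := by omega
    constructor
    · conv_lhs => rw [e3]
      rw [Nat.add_mul_mod_self_left, Nat.mod_eq_of_lt (by omega)]
      omega
    · conv_lhs => rw [e3]
      rw [Nat.add_mul_div_left _ _ hM0, Nat.div_eq_of_lt (by omega), zero_add]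
  have hudiv : u / p ^ b = k := by
    rw [huk, Nat.add_mul_div_left _ _ hP, Nat.div_eq_of_lt hslt, zero_add]
  have humod : u % p ^ b = s := by
    rw [huk, Nat.add_mul_mod_self_left, Nat.mod_eq_of_lt hslt]
  refine ⟨hu, ?_, ?_⟩
  · rw [hdb]
    unfold dig
    rw [hudiv]
    exact (hdec p dvd_rfl (by omega)).1
  · intro c hc
    obtain ⟨n, rfl⟩ : ∃ n, c = b + (n + 1) := ⟨c - b - 1, by omega⟩
    obtain ⟨d1, d2⟩ := hdec (p ^ (n + 1)) (dvd_pow_self p (by omega)) (by positivity)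
    constructor
    · unfold dig
      rw [pow_add, ← Nat.div_div_eq_div_mul, ← Nat.div_div_eq_div_mul, hudiv, d2]
    · rw [pow_add, Nat.mod_mul, Nat.mod_mul, hudiv, humod, ← hr, ← hq', ← d1]
      push_cast
      ring

/-- For adjacent stretches `S' > S`: `S'` is up-admissible for `v` and `S` is
up-admissible for `v(S')` iff `S` is down-admissible for `v` and `S'` is
up-admissible for `v[S]`; in this case `v(S')(S) = v[S](S')`. -/
theorem stmt3 (p v : ℕ) (hp : p.Prime) (hv : 1 ≤ v) (S S' : Finset ℕ)
    (hS : IsStretch S) (hS' : IsStretch S')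
    (hlt : ∀ a ∈ S, ∀ b ∈ S', a < b)
    (hadj : ∃ a ∈ S, a + 1 ∈ S') :
    ((UpAdm p v S' ∧ UpAdm p (vupN p v S') S) ↔
      (DownAdm p v S ∧ UpAdm p (vdownN p v S) S')) ∧
    ((UpAdm p v S' ∧ UpAdm p (vupN p v S') S) →
      vupN p (vupN p v S') S = vupN p (vdownN p v S) S') := by
  obtain ⟨a, b, c, hab, hbc, rfl, rfl⟩ := exists_Ico S S' hS hS' hlt hadj
  have hp2 := hp.two_le
  obtain ⟨hw, hwb, hwd⟩ := up_data p v b c hp2 hbc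
  have hwa := dig_low p _ _ a b hab hwb
  rw [upAdm_Ico _ _ _ _ hbc, upAdm_Ico _ _ _ _ hab, upAdm_Ico _ _ _ _ hbc,
    downAdm_Ico _ _ _ _ hab, hwa, Ne, Ne, Ne, Ne, hwd]
  refine ⟨⟨?_, ?_⟩, ?_⟩
  · rintro ⟨⟨h1, h2⟩, h3, h4⟩
    obtain ⟨-, d1, d2⟩ := down_data p v a b hp2 hab h3 h1
    have d3 := (d2 c hbc).1
    refine ⟨⟨h3, h1⟩, by omega, by omega⟩
  · rintro ⟨⟨h1, h2⟩, h3, h4⟩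
    obtain ⟨-, d1, d2⟩ := down_data p v a b hp2 hab h1 h2
    have d3 := (d2 c hbc).1
    refine ⟨⟨h2, by omega⟩, h1, by omega⟩
  · rintro ⟨⟨h1, h2⟩, h3, h4⟩
    obtain ⟨hu, -, d2⟩ := down_data p v a b hp2 hab h3 h1
    have d3 := (d2 c hbc).2
    obtain ⟨e1, -, -⟩ := up_data p (vupN p v (Finset.Ico b c)) a b hp2 hab
    obtain ⟨e2, -, -⟩ := up_data p (vdownN p v (Finset.Ico a b)) b c hp2 hbc
    have e3 : vupN p v (Finset.Ico b c) % p ^ a = v % p ^ a := by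
      rw [← Nat.mod_mod_of_dvd _ (pow_dvd_pow p hab.le), hwb,
        Nat.mod_mod_of_dvd _ (pow_dvd_pow p hab.le)]
    rw [e3, hwb, hw] at e1
    rw [d3, hu] at e2
    zify
    rw [e1, e2]
    ring

end SL2Tilt
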